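/- For every matching instance with strict preferences, the set of stable fractional matchings either consists of exactly one element or is uncountable. -/

import Mathlib

open Finset

/-- Nonnegativity of valuations: part of the definition of a matching instance. -/
def Nonneg {n : ℕ} (U V : Fin n → Fin n → ℝ) : Prop :=
  ∀ m w, 0 ≤ U m w ∧ 0 ≤ V m w

/-- Strict preferences: each agent's valuations over the other side are injective. -/
def StrictPrefs {n : ℕ} (U V : Fin n → Fin n → ℝ) : Prop :=
  (∀ m, Function.Injective fun w => U m w) ∧ (∀ w, Function.Injective fun m => V m w)

/-- A fractional matching. -/
def IsFracMatching {n : ℕ} (μ : Fin n → Fin n → ℝ) : Prop :=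
  (∀ m w, 0 ≤ μ m w) ∧ (∀ m, ∑ w, μ m w ≤ 1) ∧ (∀ w, ∑ m, μ m w ≤ 1)

/-- Utility of man `m` under fractional matching `μ`. -/
def manUtil {n : ℕ} (U μ : Fin n → Fin n → ℝ) (m : Fin n) : ℝ :=
  ∑ w, μ m w * U m w

/-- Utility of woman `w` under fractional matching `μ`. -/
def womanUtil {n : ℕ} (V μ : Fin n → Fin n → ℝ) (w : Fin n) : ℝ :=
  ∑ m, μ m w * V m w

/-- `(m, w)` blocks `μ`. -/
def Blocks {n : ℕ} (U V μ : Fin n → Fin n → ℝ) (m w : Fin n) : Prop :=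
  U m w > manUtil U μ m ∧ V m w > womanUtil V μ w

/-- Stability of a fractional matching. -/
def IsStable {n : ℕ} (U V μ : Fin n → Fin n → ℝ) : Prop :=
  ¬ ∃ m w, Blocks U V μ m w

/-- Integral matchings: all weights are 0 or 1. -/
def Integral {n : ℕ} (μ : Fin n → Fin n → ℝ) : Prop :=
  ∀ m w, μ m w = 0 ∨ μ m w = 1

/-- `(m, w)` is a mutual-first-preference pair. -/
def MFP {n : ℕ} (U V : Fin n → Fin n → ℝ) (m w : Fin n) : Prop :=
  (∀ w', w' ≠ w → U m w > U m w') ∧ (∀ m', m' ≠ m → V m w > V m' w)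

/-- The conditioned mutual first preference (CMFP) property. -/
def CMFP {n : ℕ} (U V : Fin n → Fin n → ℝ) : Prop :=
  ∃ mseq wseq : Equiv.Perm (Fin n),
    ∀ t s : Fin n, t < s →
      U (mseq t) (wseq t) > U (mseq t) (wseq s) ∧
      V (mseq t) (wseq t) > V (mseq s) (wseq t)

open Filter Topology

/-- `w` is the favourite of man `m` among the women who have not rejected him. -/
def IsBestRemaining {n : ℕ} (U : Fin n → Fin n → ℝ) (R : Finset (Fin n × Fin n))
    (m w : Fin n) : Prop :=
  (m, w) ∉ R ∧ ∀ w', (m, w') ∉ R → U m w' ≤ U m w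

/-- Every rejection is justified by a better man currently proposing to that woman. -/
def JustifiedRejections {n : ℕ} (U V : Fin n → Fin n → ℝ) (R : Finset (Fin n × Fin n)) : Prop :=
  ∀ m w, (m, w) ∈ R → ∃ m', V m w < V m' w ∧ IsBestRemaining U R m' w

theorem IsBestRemaining.unique {n : ℕ} {U : Fin n → Fin n → ℝ}
    (hU : ∀ m, Function.Injective fun w => U m w) {R : Finset (Fin n × Fin n)}
    {m w w' : Fin n} (h : IsBestRemaining U R m w) (h' : IsBestRemaining U R m w') : w = w' :=
  hU m (le_antisymm (h'.2 w h.1) (h.2 w' h'.1))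

theorem JustifiedRejections.exists_isBestRemaining {n : ℕ} {U V : Fin n → Fin n → ℝ}
    (hU : ∀ m, Function.Injective fun w => U m w) {R : Finset (Fin n × Fin n)}
    (hR : JustifiedRejections U V R) (m : Fin n) : ∃ w, IsBestRemaining U R m w := by
  classical
  by_cases hne : ∃ w, (m, w) ∉ R
  · obtain ⟨w₀, hw₀⟩ := hne
    obtain ⟨w, hw, hmax⟩ := Finset.exists_max_image
      (Finset.univ.filter fun w => (m, w) ∉ R) (fun w => U m w) ⟨w₀, by simp [hw₀]⟩
    exact ⟨w, by simpa using hw, fun w' hw' => hmax w' (by simp [hw'])⟩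
  · push Not at hne
    choose f hf using fun w => hR m w (hne w)
    have hinj : Function.Injective f := fun w w' h =>
      (hf w).2.unique hU (h ▸ (hf w').2)
    obtain ⟨w, hw⟩ := (Finite.injective_iff_surjective.mp hinj) m
    exact absurd (hne w) (hw ▸ (hf w).2.1)

theorem JustifiedRejections.insert {n : ℕ} {U V : Fin n → Fin n → ℝ}
    (hU : ∀ m, Function.Injective fun w => U m w) {R : Finset (Fin n × Fin n)}
    (hR : JustifiedRejections U V R) {m m' w : Fin n} (hm : IsBestRemaining U R m w)
    (hm' : IsBestRemaining U R m' w) (hlt : V m w < V m' w) :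
    JustifiedRejections U V (insert (m, w) R) := by
  have keep : ∀ a b, a ≠ m → IsBestRemaining U R a b →
      IsBestRemaining U (Insert.insert (m, w) R) a b := by
    intro a b ha hab
    refine ⟨by simp [ha, hab.1], fun w' hw' => hab.2 w' fun h => hw' (by simp [h])⟩
  have hmm : m' ≠ m := by rintro rfl; exact lt_irrefl _ hlt
  intro a b hab
  rw [Finset.mem_insert] at hab
  rcases hab with h | h
  · obtain ⟨rfl, rfl⟩ := Prod.mk.inj h
    exact ⟨m', hlt, keep _ _ hmm hm'⟩
  · obtain ⟨c, hc, hbest⟩ := hR a b h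
    by_cases hcm : c = m
    · subst hcm
      obtain rfl := hbest.unique hU hm
      exact ⟨m', hc.trans hlt, keep _ _ hmm hm'⟩
    · exact ⟨c, hc, keep _ _ hcm hbest⟩

/-- The Gale–Shapley theorem for strict preferences. -/
theorem exists_stable_perm {n : ℕ} {U V : Fin n → Fin n → ℝ} (hsp : StrictPrefs U V) :
    ∃ σ : Equiv.Perm (Fin n), ∀ m w, w ≠ σ m →
      U m w < U m (σ m) ∨ V m w < V (σ.symm w) w := by
  classical
  obtain ⟨hU, hV⟩ := hsp
  obtain ⟨R, hRmem, hmax⟩ := Finset.exists_max_image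
    (Finset.univ.filter fun R : Finset (Fin n × Fin n) => JustifiedRejections U V R)
    Finset.card ⟨∅, Finset.mem_filter.mpr
      ⟨Finset.mem_univ _, fun _ _ h => absurd h (Finset.notMem_empty _)⟩⟩
  have hR : JustifiedRejections U V R := by simpa using hRmem
  choose f hf using hR.exists_isBestRemaining hU
  have no_rival : ∀ m m', f m = f m' → ¬ V m (f m) < V m' (f m) := by
    intro m m' h hlt
    have hins := hR.insert hU (hf m) (h ▸ hf m') hlt
    have := hmax _ (by simpa using hins)
    rw [Finset.card_insert_of_notMem (hf m).1] at this
    omega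
  have hinj : Function.Injective f := fun m m' h =>
    hV (f m) (le_antisymm (not_lt.mp (by rw [h]; exact no_rival m' m h.symm))
      (not_lt.mp (no_rival m m' h)))
  refine ⟨Equiv.ofBijective f (Finite.injective_iff_bijective.mp hinj), fun m w hw => ?_⟩
  simp only [Equiv.ofBijective_apply] at hw ⊢
  by_cases hmw : (m, w) ∈ R
  · right
    obtain ⟨m', hlt, hbest⟩ := hR m w hmw
    have : f m' = w := (hf m').unique hU hbest
    rwa [(Equiv.symm_apply_eq _).mpr (show w = Equiv.ofBijective f _ m' from this.symm)]
  · left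
    exact lt_of_le_of_ne ((hf m).2 w hmw) fun h => hw (hU m h)

/-- The fractional matching given by a permutation. -/
def permMatching {n : ℕ} (σ : Equiv.Perm (Fin n)) (m w : Fin n) : ℝ :=
  if w = σ m then 1 else 0

theorem permMatching_symm {n : ℕ} (σ : Equiv.Perm (Fin n)) (m w : Fin n) :
    permMatching σ m w = if m = σ.symm w then 1 else 0 := by
  simp only [permMatching, Equiv.eq_symm_apply, eq_comm]

theorem isFracMatching_permMatching {n : ℕ} (σ : Equiv.Perm (Fin n)) :
    IsFracMatching (permMatching σ) := by
  refine ⟨fun m w => ?_, fun m => ?_, fun w => ?_⟩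
  · unfold permMatching; split_ifs <;> norm_num
  · simp [permMatching]
  · simp [permMatching_symm]

theorem manUtil_permMatching {n : ℕ} (U : Fin n → Fin n → ℝ) (σ : Equiv.Perm (Fin n))
    (m : Fin n) : manUtil U (permMatching σ) m = U m (σ m) := by
  simp [manUtil, permMatching]

theorem womanUtil_permMatching {n : ℕ} (V : Fin n → Fin n → ℝ) (σ : Equiv.Perm (Fin n))
    (w : Fin n) : womanUtil V (permMatching σ) w = V (σ.symm w) w := by
  simp [womanUtil, permMatching_symm]

/-- The point at parameter `t` on the segment from `μ` to `ν`. -/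
def mix {n : ℕ} (μ ν : Fin n → Fin n → ℝ) (t : ℝ) (m w : Fin n) : ℝ :=
  (1 - t) * μ m w + t * ν m w

theorem manUtil_mix {n : ℕ} (U μ ν : Fin n → Fin n → ℝ) (t : ℝ) (m : Fin n) :
    manUtil U (mix μ ν t) m = (1 - t) * manUtil U μ m + t * manUtil U ν m := by
  simp only [manUtil, mix, Finset.mul_sum, ← Finset.sum_add_distrib]
  exact Finset.sum_congr rfl fun _ _ => by ring

theorem womanUtil_mix {n : ℕ} (V μ ν : Fin n → Fin n → ℝ) (t : ℝ) (w : Fin n) :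
    womanUtil V (mix μ ν t) w = (1 - t) * womanUtil V μ w + t * womanUtil V ν w := by
  simp only [womanUtil, mix, Finset.mul_sum, ← Finset.sum_add_distrib]
  exact Finset.sum_congr rfl fun _ _ => by ring

theorem IsFracMatching.mix {n : ℕ} {μ ν : Fin n → Fin n → ℝ} (hμ : IsFracMatching μ)
    (hν : IsFracMatching ν) {t : ℝ} (h0 : 0 ≤ t) (h1 : t ≤ 1) :
    IsFracMatching (mix μ ν t) := by
  have h1' : 0 ≤ 1 - t := by linarith
  refine ⟨fun m w => add_nonneg (mul_nonneg h1' (hμ.1 m w)) (mul_nonneg h0 (hν.1 m w)),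
    fun m => ?_, fun w => ?_⟩
  · simp only [_root_.mix, Finset.sum_add_distrib, ← Finset.mul_sum]
    nlinarith [hμ.2.1 m, hν.2.1 m]
  · simp only [_root_.mix, Finset.sum_add_distrib, ← Finset.mul_sum]
    nlinarith [hμ.2.2 w, hν.2.2 w]

theorem mix_injective {n : ℕ} {μ ν : Fin n → Fin n → ℝ} (h : μ ≠ ν) :
    Function.Injective (mix μ ν) := by
  intro s t hst
  by_contra hne
  refine h (funext fun m => funext fun w => ?_)
  have hmw := congrFun (congrFun hst m) w
  simp only [mix] at hmw
  have : (s - t) * (μ m w - ν m w) = 0 := by linear_combination -hmw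
  rcases mul_eq_zero.mp this with h' | h'
  · exact absurd (sub_eq_zero.mp h') hne
  · exact sub_eq_zero.mp h'

/-- Near a strictly stable permutation, the segment towards any stable `ν` is stable. -/
theorem eventually_isStable_mix {n : ℕ} {U V : Fin n → Fin n → ℝ} {σ : Equiv.Perm (Fin n)}
    (hσ : ∀ m w, w ≠ σ m → U m w < U m (σ m) ∨ V m w < V (σ.symm w) w)
    {ν : Fin n → Fin n → ℝ} (hν : IsStable U V ν) :
    ∀ᶠ t in 𝓝[>] (0 : ℝ), IsStable U V (mix (permMatching σ) ν t) := by
  have tends : ∀ a b : ℝ, Tendsto (fun t : ℝ => (1 - t) * a + t * b) (𝓝[>] 0) (𝓝 a) := by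
    intro a b
    have : ContinuousAt (fun t : ℝ => (1 - t) * a + t * b) 0 := by fun_prop
    simpa [ContinuousAt] using this.tendsto.mono_left nhdsWithin_le_nhds
  have key : ∀ m w, ∀ᶠ t in 𝓝[>] (0 : ℝ), ¬ Blocks U V (mix (permMatching σ) ν t) m w := by
    intro m w
    simp only [Blocks, manUtil_mix, womanUtil_mix, manUtil_permMatching, womanUtil_permMatching]
    by_cases hw : w = σ m
    · subst hw
      filter_upwards [self_mem_nhdsWithin] with t ht
      have ht : 0 < t := ht
      rintro ⟨h₁, h₂⟩
      rw [Equiv.symm_apply_apply] at h₂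
      exact hν ⟨m, σ m, by
        constructor <;> refine lt_of_mul_lt_mul_left ?_ ht.le <;> linarith⟩
    · rcases hσ m w hw with h | h
      · filter_upwards [(tends _ (manUtil U ν m)).eventually (eventually_gt_nhds h)] with t ht hb
        exact lt_asymm ht hb.1
      · filter_upwards [(tends _ (womanUtil V ν w)).eventually (eventually_gt_nhds h)] with t ht hb
        exact lt_asymm ht hb.2
  filter_upwards [eventually_all.mpr fun m => eventually_all.mpr (key m)] with t ht
  rintro ⟨m, w, hb⟩
  exact ht m w hb

theorem isStable_permMatching {n : ℕ} {U V : Fin n → Fin n → ℝ} {σ : Equiv.Perm (Fin n)}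
    (hσ : ∀ m w, w ≠ σ m → U m w < U m (σ m) ∨ V m w < V (σ.symm w) w) :
    IsStable U V (permMatching σ) := by
  rintro ⟨m, w, h₁, h₂⟩
  rw [manUtil_permMatching] at h₁
  rw [womanUtil_permMatching] at h₂
  by_cases hw : w = σ m
  · exact lt_irrefl _ (hw ▸ h₁)
  · rcases hσ m w hw with h | h
    · exact lt_asymm h h₁
    · exact lt_asymm h h₂

/-- For every matching instance with strict preferences, the set
of stable fractional matchings either has exactly one element or is
uncountable. -/
theorem unique_or_uncountable {n : ℕ} (U V : Fin n → Fin n → ℝ)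
    (hnn : Nonneg U V) (hsp : StrictPrefs U V) :
    (∃! μ : Fin n → Fin n → ℝ, IsFracMatching μ ∧ IsStable U V μ) ∨
      ¬ Set.Countable {μ : Fin n → Fin n → ℝ | IsFracMatching μ ∧ IsStable U V μ} := by
  obtain ⟨σ, hσ⟩ := exists_stable_perm hsp
  have hM := isFracMatching_permMatching σ
  by_cases huniq : ∀ ν, IsFracMatching ν ∧ IsStable U V ν → ν = permMatching σ
  · exact Or.inl ⟨permMatching σ, ⟨hM, isStable_permMatching hσ⟩, huniq⟩
  · right
    push Not at huniq
    obtain ⟨ν, ⟨hν, hνs⟩, hne⟩ := huniq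
    intro hcount
    have hmem : mix (permMatching σ) ν ⁻¹' {μ | IsFracMatching μ ∧ IsStable U V μ} ∈
        𝓝[>] (0 : ℝ) := by
      filter_upwards [eventually_isStable_mix hσ hνs, Ioo_mem_nhdsGT zero_lt_one] with t ht ht'
      exact ⟨hM.mix hν ht'.1.le ht'.2.le, ht⟩
    obtain ⟨δ, hδ, hsub⟩ := mem_nhdsGT_iff_exists_Ioo_subset.mp hmem
    have hIoo := (hcount.preimage (mix_injective hne.symm)).mono hsub
    have hzero := hIoo.measure_zero MeasureTheory.volume
    rw [Real.volume_Ioo, ENNReal.ofReal_eq_zero] at hzero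
    exact absurd (Set.mem_Ioi.mp hδ) (by linarith)
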